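/- There are exactly 8·(8−1)·(8−2)·(8−4) = 1344 antilinear permutations of ZZ_2^3. -/

import Mathlib

/-- The group `ZZ_2^3`. -/
abbrev V3 := Fin 3 → ZMod 2

/-- A permutation of `ZZ_2^3` is antilinear if it fixes `0` and no three nonzero elements
summing to zero are mapped to three elements summing to zero. -/
def Antilinear (π : Equiv.Perm V3) : Prop :=
  π 0 = 0 ∧ ∀ x y z : V3, x ≠ 0 → y ≠ 0 → z ≠ 0 → x + y + z ≠ 0 ∨ π x + π y + π z ≠ 0

/-- The standard inner product (dot product mod 2) on `ZZ_2^3`. -/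
def dotp (x y : V3) : ZMod 2 := ∑ j, x j * y j

/-- The signature of a permutation of `ZZ_2^3`. -/
def sig (π : Equiv.Perm V3) (x : V3) : V3 :=
  ∑ y ∈ Finset.univ.filter (fun y => dotp x y = 0), π y

/-- A Fano permutation is an antilinear permutation whose signature is the identity. -/
def Fano (π : Equiv.Perm V3) : Prop := Antilinear π ∧ ∀ x, sig π x = x

/-- Identification of `{0,…,7}` with `ZZ_2^3` via binary representation. -/
def ofN (i : Fin 8) : V3 := fun j => if Nat.testBit i.val j.val then 1 else 0

/-- Identification of `ZZ_2^3` with `{0,…,7}` via binary representation. -/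
def toN (x : V3) : Fin 8 :=
  ⟨(x 0).val + 2 * (x 1).val + 4 * (x 2).val, by
    have h0 := ZMod.val_lt (x 0); have h1 := ZMod.val_lt (x 1)
    have h2 := ZMod.val_lt (x 2); omega⟩

/-- The permutation of `ZZ_2^3` described, via the binary identification, by a
table of images of `0,…,7`. -/
noncomputable def permOf (v : Fin 8 → Fin 8) (h : Function.Bijective fun x : V3 => ofN (v (toN x))) :
    Equiv.Perm V3 :=
  Equiv.ofBijective _ h
/-- The binary identification as an equivalence. -/
def eN : Fin 8 ≃ V3 where
  toFun := ofN
  invFun := toN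
  left_inv := by unfold Function.LeftInverse; decide +kernel
  right_inv := by unfold Function.RightInverse Function.LeftInverse; decide +kernel

theorem eN_zero : eN 0 = 0 := by decide +kernel

theorem eN_xor : ∀ a b : Fin 8, eN (a ^^^ b) = eN a + eN b := by decide +kernel

theorem eN_xor3 (a b c : Fin 8) : eN a + eN b + eN c = 0 ↔ a ^^^ b ^^^ c = 0 := by
  rw [← eN_xor, ← eN_xor, ← eN_zero, eN.injective.eq_iff]

/-- Antilinearity transported to `Fin 8`. -/
def PN (σ : Equiv.Perm (Fin 8)) : Prop :=
  σ 0 = 0 ∧ ∀ x y z : Fin 8, x ≠ 0 → y ≠ 0 → z ≠ 0 → x ^^^ y ^^^ z = 0 →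
    σ x ^^^ σ y ^^^ σ z ≠ 0

theorem PN_iff (σ : Equiv.Perm (Fin 8)) : PN σ ↔ Antilinear (eN.permCongr σ) := by
  have hne : ∀ x : Fin 8, eN x ≠ 0 ↔ x ≠ 0 := fun x => by
    rw [← eN_zero, eN.injective.ne_iff]
  have h0 : eN.symm 0 = 0 := by rw [← eN_zero, Equiv.symm_apply_apply]
  unfold PN Antilinear
  refine and_congr ?_ ?_
  · rw [Equiv.permCongr_apply, h0, ← eN_zero, eN.injective.eq_iff]
  · constructor
    · intro h x y z hx hy hz
      obtain ⟨x, rfl⟩ := eN.surjective x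
      obtain ⟨y, rfl⟩ := eN.surjective y
      obtain ⟨z, rfl⟩ := eN.surjective z
      rw [hne] at hx hy hz
      simp only [Equiv.permCongr_apply, Equiv.symm_apply_apply, ne_eq, eN_xor3]
      exact not_or_of_imp (h x y z hx hy hz)
    · intro h x y z hx hy hz h1
      have := h (eN x) (eN y) (eN z) ((hne x).2 hx) ((hne y).2 hy) ((hne z).2 hz)
      simp only [Equiv.permCongr_apply, Equiv.symm_apply_apply, ne_eq, eN_xor3] at this
      exact this.resolve_left (not_not.2 h1)

abbrev T7 := Σ _ : Fin 8, Σ _ : Fin 8, Σ _ : Fin 8, Σ _ : Fin 8, Σ _ : Fin 8, Σ _ : Fin 8, Fin 8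

/-- All admissible tables of images of `1,…,7`. -/
def S7 : Finset T7 :=
  (Finset.univ.filter fun a => a ≠ 0).sigma fun a =>
  (Finset.univ.filter fun b => b ≠ 0 ∧ b ≠ a).sigma fun b =>
  (Finset.univ.filter fun c => c ≠ 0 ∧ c ≠ a ∧ c ≠ b ∧ a ^^^ b ^^^ c ≠ 0).sigma fun c =>
  (Finset.univ.filter fun d => d ≠ 0 ∧ d ≠ a ∧ d ≠ b ∧ d ≠ c).sigma fun d =>
  (Finset.univ.filter fun e => e ≠ 0 ∧ e ≠ a ∧ e ≠ b ∧ e ≠ c ∧ e ≠ d ∧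
    a ^^^ d ^^^ e ≠ 0).sigma fun e =>
  (Finset.univ.filter fun f => f ≠ 0 ∧ f ≠ a ∧ f ≠ b ∧ f ≠ c ∧ f ≠ d ∧ f ≠ e ∧
    b ^^^ d ^^^ f ≠ 0 ∧ c ^^^ e ^^^ f ≠ 0).sigma fun f =>
  (Finset.univ.filter fun g => g ≠ 0 ∧ g ≠ a ∧ g ≠ b ∧ g ≠ c ∧ g ≠ d ∧ g ≠ e ∧ g ≠ f ∧
    a ^^^ f ^^^ g ≠ 0 ∧ b ^^^ e ^^^ g ≠ 0 ∧ c ^^^ d ^^^ g ≠ 0)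

/-- Sum over `0,…,7`, restricted by a Boolean test, in plain natural-number arithmetic. -/
def gsum (q : ℕ → Bool) (F : ℕ → ℕ) : ℕ :=
  Nat.add (Nat.add (Nat.add (Nat.add (Nat.add (Nat.add (Nat.add
    (cond (q 0) (F 0) 0) (cond (q 1) (F 1) 0)) (cond (q 2) (F 2) 0)) (cond (q 3) (F 3) 0))
    (cond (q 4) (F 4) 0)) (cond (q 5) (F 5) 0)) (cond (q 6) (F 6) 0)) (cond (q 7) (F 7) 0)

theorem sum_eq_gsum (p : Fin 8 → Prop) [DecidablePred p] (q : ℕ → Bool) (F : Fin 8 → ℕ)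
    (F' : ℕ → ℕ) (hq : ∀ a : Fin 8, p a ↔ q a.val = true) (hF : ∀ a : Fin 8, F a = F' a.val) :
    ∑ a ∈ Finset.univ.filter p, F a = gsum q F' := by
  have h : ∀ a : Fin 8, (if p a then F a else 0) = cond (q a.val) (F' a.val) 0 := by
    intro a
    by_cases h : p a
    · rw [if_pos h, (hq a).1 h, hF]; rfl
    · rw [if_neg h, Bool.eq_false_iff.2 (fun h' => h ((hq a).2 h'))]; rfl
  rw [Finset.sum_filter, Fin.sum_univ_eight]
  simp only [h]
  rfl

/-- Boolean test for `a ≠ b`. -/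
def nb (a b : ℕ) : Bool := not (Nat.beq a b)

/-- Boolean test for `a ⊕ b ⊕ c ≠ 0`. -/
def nx (a b c : ℕ) : Bool := not (Nat.beq (Nat.xor (Nat.xor a b) c) 0)

theorem nb_iff (a b : Fin 8) : nb a.val b.val = true ↔ a ≠ b := by
  rw [nb, Bool.not_eq_true_eq_eq_false, ← Bool.not_eq_true, Nat.beq_eq, ne_eq, Fin.ext_iff]

theorem nb_zero (a : Fin 8) : nb a.val 0 = true ↔ a ≠ 0 := nb_iff a 0

theorem xor_val : ∀ a b : Fin 8, (a ^^^ b).val = Nat.xor a.val b.val := by decide +kernel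

theorem nx_iff (a b c : Fin 8) : nx a.val b.val c.val = true ↔ a ^^^ b ^^^ c ≠ 0 := by
  unfold nx
  rw [← xor_val, ← xor_val]
  exact nb_zero _

/-- The number of admissible tables, in plain natural-number arithmetic. -/
def cnt : ℕ :=
  gsum (fun a => nb a 0) fun a =>
  gsum (fun b => nb b 0 && nb b a) fun b =>
  gsum (fun c => nb c 0 && (nb c a && (nb c b && nx a b c))) fun c =>
  gsum (fun d => nb d 0 && (nb d a && (nb d b && nb d c))) fun d =>
  gsum (fun e => nb e 0 && (nb e a && (nb e b && (nb e c && (nb e d && nx a d e))))) fun e =>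
  gsum (fun f => nb f 0 && (nb f a && (nb f b && (nb f c && (nb f d && (nb f e &&
    (nx b d f && nx c e f))))))) fun f =>
  gsum (fun g => nb g 0 && (nb g a && (nb g b && (nb g c && (nb g d && (nb g e && (nb g f &&
    (nx a f g && (nx b e g && nx c d g))))))))) fun _ => 1

theorem cnt_eq : cnt = 1344 := by decide +kernel

theorem S7_card : S7.card = 1344 := by
  rw [← cnt_eq]
  unfold S7 cnt
  simp only [Finset.card_sigma]
  refine sum_eq_gsum _ _ _ _ (fun a => ?_) (fun a => ?_)
  · simp only [nb_zero]
  refine sum_eq_gsum _ _ _ _ (fun b => ?_) (fun b => ?_)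
  · simp only [nb_zero, nb_iff, Bool.and_eq_true]
  refine sum_eq_gsum _ _ _ _ (fun c => ?_) (fun c => ?_)
  · simp only [nb_zero, nb_iff, nx_iff, Bool.and_eq_true]
  refine sum_eq_gsum _ _ _ _ (fun d => ?_) (fun d => ?_)
  · simp only [nb_zero, nb_iff, Bool.and_eq_true]
  refine sum_eq_gsum _ _ _ _ (fun e => ?_) (fun e => ?_)
  · simp only [nb_zero, nb_iff, nx_iff, Bool.and_eq_true]
  refine sum_eq_gsum _ _ _ _ (fun f => ?_) (fun f => ?_)
  · simp only [nb_zero, nb_iff, nx_iff, Bool.and_eq_true]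
  rw [Finset.card_eq_sum_ones]
  refine sum_eq_gsum _ _ _ _ (fun g => ?_) (fun g => rfl)
  simp only [nb_zero, nb_iff, nx_iff, Bool.and_eq_true]

/-- The table of a permutation. -/
def tab (σ : Equiv.Perm (Fin 8)) : T7 := ⟨σ 1, σ 2, σ 3, σ 4, σ 5, σ 6, σ 7⟩

theorem tab_mem (σ : Equiv.Perm (Fin 8)) (h : PN σ) : tab σ ∈ S7 := by
  obtain ⟨h0, h⟩ := h
  have hz : ∀ x, σ x = 0 ↔ x = 0 := fun x => by
    conv_lhs => rw [← h0, σ.injective.eq_iff]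
  simp only [tab, S7, Finset.mem_sigma, Finset.mem_filter, Finset.mem_univ, true_and, ne_eq,
    hz, σ.injective.eq_iff]
  refine ⟨?_, ?_, ?_, ?_, ?_, ?_, ?_⟩
  all_goals repeat' refine And.intro ?_ ?_
  all_goals first
    | decide
    | exact h _ _ _ (by decide) (by decide) (by decide) (by decide)

theorem tab_inj (σ τ : Equiv.Perm (Fin 8)) (hσ : PN σ) (hτ : PN τ) (h : tab σ = tab τ) :
    σ = τ := by
  have h0 : σ 0 = τ 0 := hσ.1.trans hτ.1.symm
  simp only [tab, Sigma.mk.injEq, heq_eq_eq] at h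
  obtain ⟨h1, h2, h3, h4, h5, h6, h7⟩ := h
  ext1 x
  fin_cases x <;> assumption

theorem tab_surj (t : T7) (ht : t ∈ S7) : ∃ σ, PN σ ∧ tab σ = t := by
  obtain ⟨a, b, c, d, e, f, g⟩ := t
  simp only [S7, Finset.mem_sigma, Finset.mem_filter, Finset.mem_univ, true_and] at ht
  let F : Fin 8 → Fin 8 := ![0, a, b, c, d, e, f, g]
  have hlt : ∀ i j : Fin 8, i < j → F j ≠ F i := by
    intro i j hij
    fin_cases i <;> fin_cases j <;>
      first
        | exact absurd hij (by decide)
        | (simp only [F]; tauto)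
  have hinj : Function.Injective F := by
    intro i j hij
    rcases lt_trichotomy i j with h | h | h
    · exact absurd hij.symm (hlt i j h)
    · exact h
    · exact absurd hij (hlt j i h)
  refine ⟨Equiv.ofBijective F (Finite.injective_iff_bijective.mp hinj), ⟨rfl, ?_⟩, rfl⟩
  -- sorted triples suffice
  have hs : ∀ x y z : Fin 8, 0 < x → x < y → y < z → x ^^^ y ^^^ z = 0 →
      F x ^^^ F y ^^^ F z ≠ 0 := by
    have hl : ∀ x y z : Fin 8, 0 < x → x < y → y < z → x ^^^ y ^^^ z = 0 →
      (x = 1 ∧ y = 2 ∧ z = 3) ∨ (x = 1 ∧ y = 4 ∧ z = 5) ∨ (x = 1 ∧ y = 6 ∧ z = 7) ∨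
      (x = 2 ∧ y = 4 ∧ z = 6) ∨ (x = 2 ∧ y = 5 ∧ z = 7) ∨ (x = 3 ∧ y = 4 ∧ z = 7) ∨
      (x = 3 ∧ y = 5 ∧ z = 6) := by decide +kernel
    intro x y z hx hy hz h
    rcases hl x y z hx hy hz h with h | h | h | h | h | h | h <;>
      obtain ⟨rfl, rfl, rfl⟩ := h
    · change a ^^^ b ^^^ c ≠ 0; tauto
    · change a ^^^ d ^^^ e ≠ 0; tauto
    · change a ^^^ f ^^^ g ≠ 0; tauto
    · change b ^^^ d ^^^ f ≠ 0; tauto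
    · change b ^^^ e ^^^ g ≠ 0; tauto
    · change c ^^^ d ^^^ g ≠ 0; tauto
    · change c ^^^ e ^^^ f ≠ 0; tauto
  have c1 : ∀ x y z : Fin 8, x ^^^ y ^^^ z = y ^^^ x ^^^ z := by decide +kernel
  have c2 : ∀ x y z : Fin 8, x ^^^ y ^^^ z = x ^^^ z ^^^ y := by decide +kernel
  have hd : ∀ x y z : Fin 8, x ≠ 0 → y ≠ 0 → z ≠ 0 → x ^^^ y ^^^ z = 0 →
      x ≠ y ∧ y ≠ z ∧ x ≠ z := by decide +kernel
  intro x y z hx hy hz h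
  change F x ^^^ F y ^^^ F z ≠ 0
  obtain ⟨d1, d2, d3⟩ := hd x y z hx hy hz h
  have hx := Fin.pos_of_ne_zero hx
  have hy := Fin.pos_of_ne_zero hy
  have hz := Fin.pos_of_ne_zero hz
  rcases lt_or_gt_of_ne d1 with h1 | h1 <;> rcases lt_or_gt_of_ne d2 with h2 | h2 <;>
    rcases lt_or_gt_of_ne d3 with h3 | h3
  · exact hs x y z hx h1 h2 h
  · exact absurd (h1.trans h2) h3.asymm
  · rw [c2] at h ⊢; exact hs x z y hx h3 h2 h
  · rw [c2, c1] at h ⊢; exact hs z x y hz h3 h1 h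
  · rw [c1] at h ⊢; exact hs y x z hy h1 h3 h
  · rw [c1, c2] at h ⊢; exact hs y z x hy h2 h3 h
  · exact absurd (h2.trans h1) h3.asymm
  · rw [c1, c2, c1] at h ⊢; exact hs z y x hz h2 h1 h

theorem card_PN (S : Finset T7) (hm : ∀ σ, PN σ → tab σ ∈ S)
    (hs : ∀ t ∈ S, ∃ σ, PN σ ∧ tab σ = t) : Nat.card {σ // PN σ} = S.card := by
  refine Eq.trans ?_ (Nat.card_eq_finsetCard S)
  refine Nat.card_congr (Equiv.ofBijective
    (fun σ : {σ // PN σ} => (⟨tab σ.1, hm σ.1 σ.2⟩ : S)) ⟨?_, ?_⟩)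
  · intro σ τ h
    exact Subtype.ext (tab_inj _ _ σ.2 τ.2 (congrArg Subtype.val h))
  · rintro ⟨t, ht⟩
    obtain ⟨σ, hσ, rfl⟩ := hs t ht
    exact ⟨⟨σ, hσ⟩, rfl⟩

/-- There are exactly `8·(8-1)·(8-2)·(8-4) = 1344` antilinear permutations of `ZZ_2^3`. -/
theorem stmt15 : Nat.card {π : Equiv.Perm V3 // Antilinear π} = 1344 :=
  (Nat.card_congr (Equiv.subtypeEquiv eN.permCongr PN_iff)).symm.trans
    ((card_PN S7 tab_mem tab_surj).trans S7_card)
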